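/- The Whitten group Γ₄ (a group of order 768) has exactly 9417 subgroups, and these subgroups fall into exactly 994 conjugacy classes. -/

import Mathlib

/-- The homomorphism `ω : S_μ → Aut(Z₂^{μ+1})`: a permutation `p` fixes the 0th
coordinate (indexed by `none`) and permutes the remaining `μ` coordinates
(indexed by `some i`). -/
def whittenHom (μ : ℕ) :
    Equiv.Perm (Fin μ) →* MulAut (Option (Fin μ) → Multiplicative (ZMod 2)) where
  toFun p := MulEquiv.arrowCongr (Equiv.optionCongr p) (MulEquiv.refl _)
  map_one' := by
    ext f x
    cases x <;> rfl
  map_mul' := by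
    intro p q
    ext f x
    cases x <;> rfl

/-- The Whitten group `Γ_μ = Z₂^{μ+1} ⋊_ω S_μ`. -/
abbrev WhittenGroup (μ : ℕ) : Type :=
  (Option (Fin μ) → Multiplicative (ZMod 2)) ⋊[whittenHom μ] Equiv.Perm (Fin μ)

/-- Two subgroups are conjugate if one is carried to the other by conjugation. -/
def subgroupConj {G : Type*} [Group G] (H K : Subgroup G) : Prop :=
  ∃ γ : G, Subgroup.map (MulAut.conj γ).toMonoidHom H = K

namespace WhittenGroup

/-! ### Numerical model of the group of order 768 -/

/-- The vector whose coordinates are the five lowest binary digits of `v`; the coordinate fixed by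
the permutations is the highest one. -/
def vec (v : ℕ) : Option (Fin 4) → Multiplicative (ZMod 2) :=
  fun o => Multiplicative.ofAdd (if v.testBit (o.elim 4 Fin.val) then 1 else 0)

/-- An enumeration of the permutations of four letters by `q < 24`, starting at the identity. -/
def perm (q : ℕ) : Equiv.Perm (Fin 4) :=
  Equiv.swap 3 (Fin.ofNat 4 (3 - q / 6)) * Equiv.swap 2 (Fin.ofNat 4 (2 - q / 2 % 3)) *
    Equiv.swap 1 (Fin.ofNat 4 (1 - q % 2))

/-- An enumeration of `Γ₄` by the numbers below 768. -/
def elt (i : ℕ) : WhittenGroup 4 := ⟨vec (i % 32), perm (i / 32)⟩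

/-- The composition table of `perm`, with five binary digits for each product. -/
def permMulTable : ℕ :=
  478505153749352775169763568234277110790350106022127875648551530415754113662376296078499532241088188916366255588991723293710131008834518635662013558306608286769539151051721501004576515127986693558764974120551237267322602386023995058496943430026156721721484308715350215750659293316114993056425397839686212566736579086011352980381100524753547009432202822526473088784558226784138435364645874663988969831139789507322361291298511516201694695190552026943966255621002346131620490357525830759755540145699282463154292825795684381514144274876916159530048440272127160594197819592730188414602278245795078500893594037295997253633308285666136389932101063501852023370550619479639218435096080973973737102720186366319161148059822618844674831115796106268498539483722170526681589799957360174212127493813541587114003112779775189055509122273460901956317709163186267215541286442169077434400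

/-- The table of the action of `perm q` on `vec v`, with five binary digits for each entry. -/
def actTable : ℕ :=
  9000747306825568550925181112092397707638062940581671355502785085380174369621912527688564447088516179515802723638912892157933735859010684447483938592298020093317680865242774097372732405026060951504290934658555980336366988739695639264626417089223561124273159223200004627937522325699493984984718409211158578836492599210915083688933328914698292651039587107536448971479046385413543162213288073542013030608667108011690946197130971893743491556553434354846099487511885830274163609189443860826573958897178106381619223239942236195999621580881465588682675850097415911448533662807865635677587008041251411987264108005569166008553364659944033028568150948976127690575754345900580540532341655071229468716366609530006283008681712248580415436829881740447939676551942458056062328417198756674519503661764896551829193267334244748988138324757975010208701676830100912693401712842294869210486068366548952840644200903016416236126619651803577078295473837418384841847607173972845673973043141480295059837311593815802198942688717237145757342682917598531127411114804390871992564917352575825853662804946712736417456868951093038546761061914874238704019155904980200736561721425217617758240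

/-- Multiplication of permutations in the numbering `perm`. -/
def permMul (q r : ℕ) : ℕ :=
  Nat.land (Nat.shiftRight permMulTable (Nat.mul 5 (Nat.add (Nat.mul 24 q) r))) 31

/-- The action of permutations on vectors in the numberings `perm` and `vec`. -/
def act (q v : ℕ) : ℕ :=
  Nat.land (Nat.shiftRight actTable (Nat.mul 5 (Nat.add (Nat.mul 32 q) v))) 31

/-- Multiplication in the numbering `elt`. -/
def mul (i j : ℕ) : ℕ :=
  Nat.add (Nat.mul 32 (permMul (Nat.div i 32) (Nat.div j 32)))
    (Nat.xor (Nat.mod i 32) (act (Nat.div i 32) (Nat.mod j 32)))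

/-- `Nat.testBit`, in terms of operations the kernel evaluates directly. -/
def bit (m i : ℕ) : Bool := Nat.beq (Nat.land (Nat.shiftRight m i) 1) 1

/-! ### Strict evaluation -/

/-- Application of `k` to `n`, arranged so that the kernel evaluates `n` first. -/
def force {α : Type*} (n : ℕ) (k : ℕ → α) : α :=
  match n with
  | 0 => k 0
  | p + 1 => k (Nat.succ p)

/-- An encoding of `n` whose low digits vary with all digits of `n`. As the hash code of a numeral
depends on these only, this keeps large numerals apart in the caches of the kernel. -/
def tag (n : ℕ) : ℕ := Nat.lor (Nat.shiftLeft n 64) (Nat.mod n 18446744073709551557)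

/-- `force` by way of `tag`. -/
def forceTag {α : Type*} (n : ℕ) (k : ℕ → α) : α := force (tag n) fun t => k (Nat.shiftRight t 64)

/-- Application of `k` to `l`, arranged so that the kernel evaluates `l` first. -/
def forceList {α : Type*} : List ℕ → (List ℕ → α) → α
  | [], k => k []
  | a :: l, k => force a fun a => forceList l fun l => k (a :: l)

/-! ### Search for the points reachable under a list of functions -/

section Search

variable {σ : Type} (mem : σ → ℕ → Bool) (ins : σ → ℕ → (σ → Option σ) → Option σ)

/-- Adds the images of `x` to the points `seen` so far and to the points `todo`. -/
def expand (x : ℕ) :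
    List (ℕ → ℕ) → List ℕ → σ → (List ℕ → σ → Option σ) → Option σ
  | [], todo, seen, k => k todo seen
  | f :: fs, todo, seen, k => force (f x) fun y =>
      bif mem seen y then expand x fs todo seen k
      else ins seen y fun seen => expand x fs (y :: todo) seen k

/-- Adds everything reachable from the points `todo` to the points `seen` so far. -/
def search (fs : List (ℕ → ℕ)) : ℕ → List ℕ → σ → Option σ
  | 0, _, _ => none
  | _ + 1, [], seen => some seen
  | n + 1, x :: todo, seen => expand mem ins x fs todo seen (search fs n)

end Search

/-- The bit mask of the subgroup generated by the elements numbered `gens`. -/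
def closureMask (gens : List ℕ) : ℕ :=
  (search bit (fun m y k => force (Nat.lor m (Nat.shiftLeft 1 y)) k)
    (gens.map fun s x => mul x s) 769 [0] 1).getD 0

/-- The list of the points reachable from `m`, if there are few enough of them. -/
def orbit (fs : List (ℕ → ℕ)) (m : ℕ) : Option (List ℕ) :=
  force (tag m) fun t =>
    (search (fun l y => l.any (Nat.beq y)) (fun l y k => k (y :: l))
      (fs.map fun f K => tag (f (Nat.shiftRight K 64))) 769 [t] [t]).map
    (List.map fun K => Nat.shiftRight K 64)

/-! ### Conjugation of bit masks -/

/-- Moves the digits selected by the masks in `L` up, and those selected by the masks in `R` down,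
by the numbers of places given along with the masks. -/
def shiftLayer (L R : List (ℕ × ℕ)) (m : ℕ) : ℕ :=
  Nat.lor (L.foldr (fun p r => Nat.lor (Nat.shiftLeft (Nat.land m p.1) p.2) r) 0)
    (R.foldr (fun p r => Nat.lor (Nat.shiftRight (Nat.land m p.1) p.2) r) 0)

/-- The permutation of the vectors `vec v`, within every coset of the vectors, that is part of
conjugation by `elt 32`. -/
def swapBits : ℕ → ℕ :=
  shiftLayer
   [(931510855380425361089387693077501533154131610270017966683431222815630571611826131798527045297187886770292638418278643923702948026468888634866572365024708683522672985612509943330159171378959066895157799516229881250535708112289634713, 0),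
    (207002412306761191353197265128333674034251468948892881485206938403473460358183584844117121177152863726731697426284143094156210672548641918859238303338824151893927330136113320740035371417546459310035066559162195833452379580508807714, 1)]
   [(414004824613522382706394530256667348068502937897785762970413876806946920716367169688234242354305727453463394852568286188312421345097283837718476606677648303787854660272226641480070742835092918620070133118324391666904759161017615428, 1)]

/-- The permutation of the cosets of the vectors that is part of conjugation by `elt 32`. -/
def swapBlocks : ℕ → ℕ :=
  shiftLayer
   [(115792089237316195417293883273301227089434195242432897623373675307522804678655, 0),
    (2135987035920910082279229616932235919179133537347964862094111905523500100204627893878407015956480, 64),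
    (247330401473104534047094713089704592935557324103005993786583690272304831728808305726594637031169498012795797127849235911661333176120265159113792272289946597970173123142615040, 128),
    (726838724295606890509921801691610055141362320587174446476410459910173841445449629921945328942266354949348255351381262292727973638307840, 192),
    (13407807929942597098847186273910239236930042012704388843369920083034445969792056777621235010053505504363840807472722485292991361205680392012899047377469440, 256)]
   [(1552518092300708935064817314037728579141030178990614552490246601180880170934404391881778694359893184796669066116689657986539852542415962908035976359038240277394409939690419811950981706893543331254196379067567305274552154826043555840, 256),
    (4562440617622195218393841204227186790832725986228912740544061168798063327294614330413015586210839532608325908512351362321091033295359298658901296285415462978284448519258371782166267420097904640, 192),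
    (84162174424773976111293397508459863430164265239470490427079265941851154538174100635919389413232737833125814690381480083629668606429346454499356331609054655601030917418332899382814625451788898526257817835525898240, 128),
    (39402006196394479210143053064222703722684717564295894553351865983624455682313664510648333257056914071620698169671680, 64)]

/-- The permutation of the vectors `vec v`, within every coset of the vectors, that is part of
conjugation by `elt 257`. -/
def cycleBits : ℕ → ℕ :=
  shiftLayer
   [(1164477406378902078389381044562055590198401345408884137034258074756550462795435352828173162218236325988498121651292864933995025819309738329311725658116262438355000905566565607802293280159017647903956705964250141473260668148307443715, 0),
    (72775396041012861047953993874369540699613242459487174630642677360433791510682075147760104858802196997999516421783576056906372074395677268795557343540497573199604572920363941555663614213172662279746821294317494346574240108871945216, 2),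
    (4548462252563303815497124617148096293725827653717948414415167335027111969417629696735006553675137312374969776361473503556648254649729829299722333971281098324975285807522746347228975888323291392484176330894843396660890006804496576, 4),
    (284278890785206488468570288571756018357864228357371775900947958439194498088601856045937909604696082023435611022592093972290515915608114331232645873205068645310955362970171646701810993020205712030261020680927712291305625425281036, 6)]
   [(291101584164051444191815975497478162798452969837948698522570709441735166042728300591040419435208787991998065687134304227625488297582709075182229374161990292798418291681455766222654456852690649118987285177269977386296960435487780864, 6),
    (18193849010253215261988498468592385174903310614871793657660669340108447877670518786940026214700549249499879105445894014226593018598919317198889335885124393299901143230090985388915903553293165569936705323579373586643560027217986304, 4),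
    (1137115563140825953874281154287024073431456913429487103603791833756777992354407424183751638418784328093742444090368375889162063662432457324930583492820274581243821451880686586807243972080822848121044082723710849165222501701124144, 2)]

/-- The permutation of the cosets of the vectors that is part of conjugation by `elt 257`. -/
def cycleBlocks : ℕ → ℕ :=
  shiftLayer
   [(3121748549589153507085990339243842497860593608311329790172336222580175534192044398059631429592392688689007443293418924702035499658758308218535935, 0),
    (13407807926820848549258032766824248897686199514843795235058590292862607070448175237982108678046603601728273812205785624618852263898081980339570171801763840, 256),
    (726838724126376562539020166556314215497251974491246461442634207043769196523150040769695346182515127688195408685282827655128621902725120, 288),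
    (79228162495817593519834398720, 320),
    (2135987035423586845985235064014169866455883682256196619149693890381755748887481053010428711403520, 384),
    (115792089210356248756420345214020892766250353992003419616917011526809519390720, 416),
    (340282366841710300949110269838224261120, 512),
    (18446744069414584320, 544)]
   [(361473786630489665184711955686336528382891242068196486314304665398452315837133693519198568733570775031833511564148624060300930515424123125293257933516284065292711806110504084695241791707999431422491778536950127859041566720, 544),
    (1062275985386203795906071879044434733639539045418932497297676436486744063628807260371793137360142170276535613982895330604677019335954049444512288747565628548785769373754179665914757120, 448),
    (84162174405178442873226468378290657043198878427081854621485030604166052266288011688552463597983767984396198662963841124507815231435029563795136737990259208086112468994805609037923112443648146330959112042782392320, 320),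
    (4562440616559919233007637408378701008345036358359405990923935214295713167794655433867305603790754354837057018945825922143523631364034363551366282440293753985375393123679964832780728202522787840, 288),
    (9173994461824299010522373498813326057016707842070419972593702587600649896531719506499433662417540659281920, 224),
    (1552518091939235148434327648853016623454693650607723310422050114866575505535952076044645000840694616063098460315184117324026363777954676502957949161730016120130992279042630305429629872181061290773458100491741625172239626318737571840, 192),
    (19595533238066929130169206386965386812388635805594235337685102271886088947366925815248969848729616027417638959121853374994316890704219620578742108388456507703861613528732763437618758633515742432319242240, 128),
    (1461501636990620551282746369252908412224164331520, 96),
    (247330401415518437490349607319672297136750781307679716799837925195394774261848664891775056651383195598975147641208426852151592943143634923564279446105189015029898800047063040, 64)]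

/-- The translations of the vectors, different in different cosets, that are part of conjugation
by `elt 257`. -/
def shear : ℕ → ℕ :=
  shiftLayer
   [(3121748549589153507255220667214744132995889447955440136268264207613951787058476002928591892282701951783081854395822280074302868330987819364253695, 0),
    (207002412258564686457910353180402216461234145496571097287341033636652882726365382306297916604775965964613157063421874145490883203791843614215212089641469610586655742217513376403970814980225407473501776659996257907863090204462022656, 1),
    (103501206143457785845216033044706614056482288307547583902940923278775229838339847990599805319244243570451103596640417500790255868423433108668926603428920916915082021721869225290207451828856479303465177836026382133875219916985991168, 3),
    (7087721308130428227252752912932607779631017629635203230224394237578578418725423508428130294072262532464740214022407133263755650780660279304093055810877075306556268544111022169371887783357144753014126589971837407377489920, 5),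
    (50831474028707987370250278528142466951258692923810686585328958792328142839679399079372377317027746640146546445863175341151230250746426959149679104743292712555534448685835199896108367016926004474019840, 7),
    (25415737014353993685125139264071233475629346461905343292664479396164071419839699539686188658513873320073273222931587670575615125373213479574839552371646356277767224342917599948054183508463002237009920, 9)]
   [(13012857351349244766784071303204471539522225388495535765844213450836004566957926164319328593159103139877515890140972887334714944191085301542317850814282934414216818863573811173403741956333057145349079040, 9),
    (6506428675674622383392035651602235769761112694247767882922106725418002283478963082159664296579551569938757945070486443667357472095542650771158925407141467207108409431786905586701870978166528572674539520, 7),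
    (226807081860173703272088093213843448948192564148326503367180615602514509399213552269700169410312401038871686848717028264440180824981128937730977785948066409809800593411552709419900409067428632096452050879098797036079677440, 5),
    (828009649147662286761728264357652912451858306460380671223527386230201838706718783924798442553953948563608828773123340006322046947387464869351412827431367335320656173774953802321659614630851834427721422688211057071001759335887929344, 3),
    (414004824517129372915820706360804432922468290993142194574682067273305765452730764612595833209551931929226314126843748290981766407583687228430424179282939221173311484435026752807941629960450814947003553319992515815726180408924045312, 1)]

/-- The action on bit masks of conjugation by `elt 32`. -/
def conjSwap (m : ℕ) : ℕ := forceTag (swapBits m) swapBlocks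

/-- The action on bit masks of conjugation by `elt 257`. -/
def conjCycle (m : ℕ) : ℕ := forceTag (cycleBits m) fun m => forceTag (cycleBlocks m) shear

/-! ### Representatives of the conjugacy classes of subgroups -/

/-- Generators of representatives of the conjugacy classes of subgroups. Each subgroup has the
smallest bit mask in its class, and the bit masks increase along the list. -/
def representatives : List (List ℕ) :=
  [[], [1], [3], [1,2], [3,5], [7], [3,4], [1,2,4], [7,11], [1,6,10], [15], [7,8], [6,9], [3,5,9],
  [3,4,8], [1,2,4,8], [16], [17], [1,16], [3,17], [19], [3,16], [2,17], [1,2,16], [7,19], [6,19],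
  [1,6,18], [3,5,16], [23], [7,16], [6,17], [4,19], [3,5,17], [3,4,16], [2,4,17], [1,2,4,16],
  [15,23], [15,22], [14,23], [1,14,22], [3,12,21], [3,13,20], [12,23], [3,12,20], [2,12,21],
  [1,2,12,20], [7,11,16], [6,10,17], [1,6,10,16], [3,5,9,17], [31], [15,16], [14,17], [12,19],
  [8,23], [7,11,19], [7,8,16], [6,10,19], [6,9,16], [6,8,17], [4,8,19], [3,5,9,16], [3,5,8,17],
  [3,4,8,16], [2,4,8,17], [1,2,4,8,16], [32], [33], [3,32], [33,1], [36], [4,32], [7,35], [37],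
  [33,4], [37,5], [3,36], [33,5], [3,4,32], [37,1], [33,1,4], [12,36], [15,39], [37,12], [41,13],
  [3,12,36], [37,1,12], [44], [12,32], [15,35], [8,36], [11,39], [4,8,32], [4,11,35], [7,11,32],
  [45], [33,12], [45,13], [37,8], [45,9], [33,4,8], [41,4,9], [33,5,9], [3,44], [33,13], [3,12,32],
  [37,9], [3,8,36], [37,5,9], [33,5,8], [3,4,8,32], [45,1], [33,1,12], [37,1,8], [33,1,4,8], [48],
  [16,32], [19,35], [20,36], [23,39], [28,44], [31,47], [49], [33,16], [49,17], [37,20], [49,21],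
  [45,28], [49,29], [3,48], [33,17], [3,16,32], [37,21], [3,20,36], [45,29], [3,28,44], [49,1],
  [33,1,16], [37,1,20], [45,1,28], [52], [20,32], [23,35], [16,36], [19,39], [28,40], [31,43],
  [24,44], [27,47], [4,48], [4,16,32], [4,19,35], [4,24,40], [4,27,43], [7,51], [7,16,35],
  [7,19,32], [7,24,43], [7,27,40], [53], [33,20], [53,21], [37,16], [53,17], [41,28], [53,29],
  [45,24], [53,25], [49,4], [33,4,16], [49,4,17], [41,4,24], [49,4,25], [53,5], [37,5,16],
  [33,5,17], [45,5,24], [41,5,25], [3,52], [33,21], [3,20,32], [37,17], [3,16,36], [41,29],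
  [3,28,40], [45,25], [3,24,44], [49,5], [37,5,17], [33,5,16], [45,5,25], [41,5,24], [3,4,48],
  [33,4,17], [3,4,16,32], [41,4,25], [3,4,24,40], [53,1], [33,1,20], [37,1,16], [41,1,28],
  [45,1,24], [49,1,4], [33,1,4,16], [41,1,4,24], [12,52], [12,16,36], [12,19,39], [12,20,32],
  [12,23,35], [15,55], [15,16,39], [15,19,36], [15,20,35], [53,12], [37,12,16], [53,12,17],
  [33,12,20], [53,12,21], [57,13], [41,13,16], [37,13,17], [45,13,20], [33,13,21], [3,12,52],
  [37,12,17], [3,12,16,36], [33,12,21], [3,12,20,32], [53,1,12], [37,1,12,16], [33,1,12,20], [60],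
  [28,32], [31,35], [24,36], [27,39], [16,44], [19,47], [12,48], [12,20,36], [12,23,39], [12,16,32],
  [12,19,35], [15,51], [15,20,39], [15,16,35], [15,19,32], [8,52], [8,20,32], [8,23,35], [8,16,36],
  [8,19,39], [11,55], [11,20,35], [11,23,32], [11,16,39], [11,19,36], [4,8,48], [4,8,16,32],
  [4,8,19,35], [4,11,51], [4,11,16,35], [4,11,19,32], [7,11,48], [7,11,16,32], [7,11,19,35], [61],
  [33,28], [61,29], [37,24], [61,25], [45,16], [61,17], [49,12], [37,12,20], [49,12,21], [33,12,16],
  [49,12,17], [61,13], [41,13,20], [45,13,16], [33,13,17], [53,8], [33,8,20], [53,8,21], [37,8,16],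
  [53,8,17], [61,9], [41,9,20], [33,9,21], [45,9,16], [37,9,17], [49,4,8], [33,4,8,16], [49,4,8,17],
  [57,4,9], [41,4,9,16], [33,4,9,17], [49,5,9], [33,5,9,16], [37,5,9,17], [3,60], [33,29],
  [3,28,32], [37,25], [3,24,36], [45,17], [3,16,44], [49,13], [41,13,21], [45,13,17], [33,13,16],
  [3,12,48], [37,12,21], [3,12,20,36], [33,12,17], [3,12,16,32], [53,9], [41,9,21], [33,9,20],
  [45,9,17], [37,9,16], [3,8,52], [33,8,21], [3,8,20,32], [37,8,17], [3,8,16,36], [53,5,9],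
  [33,5,9,17], [37,5,9,16], [49,5,8], [37,5,8,17], [33,5,8,16], [3,4,8,48], [33,4,8,17],
  [3,4,8,16,32], [61,1], [33,1,28], [37,1,24], [45,1,16], [49,1,12], [37,1,12,20], [33,1,12,16],
  [53,1,8], [33,1,8,20], [37,1,8,16], [49,1,4,8], [33,1,4,8,16], [96], [96,32], [96,39], [96,40],
  [96,47], [96,48], [96,55], [96,56], [96,63], [98], [98,35], [98,43], [98,51], [98,59], [96,3],
  [37,64], [33,65], [45,72], [41,73], [53,80], [49,81], [61,88], [57,89], [97,1], [97,33], [97,41],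
  [97,49], [97,57], [104], [104,32], [104,39], [104,48], [104,55], [108], [108,36], [108,35],
  [108,52], [108,51], [98,8], [98,8,35], [98,8,51], [104,3], [104,35], [104,33], [104,51], [104,49],
  [105,3], [105,33], [105,35], [105,49], [105,51], [97,9], [97,9,32], [97,9,48], [112], [112,32],
  [112,39], [112,40], [112,47], [116], [116,36], [116,35], [116,44], [116,43], [98,16], [98,16,35],
  [98,16,43], [112,3], [112,35], [112,33], [112,43], [112,41], [113,3], [113,33], [113,35],
  [113,41], [113,43], [97,17], [97,17,32], [97,17,40], [120], [120,40], [120,47], [120,32],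
  [120,39], [104,16], [104,16,32], [104,16,39], [111,23], [111,23,32], [111,23,39], [124], [124,44],
  [124,43], [124,36], [124,35], [107,23], [107,23,36], [107,23,35], [108,16], [108,16,36],
  [108,16,35], [98,24], [98,24,43], [98,24,35], [98,8,16], [98,8,16,35], [120,3], [120,43],
  [120,41], [120,35], [120,33], [104,19], [104,19,32], [104,19,33], [105,17], [105,17,32],
  [105,17,33], [121,3], [121,41], [121,43], [121,33], [121,35], [105,19], [105,19,33], [105,19,32],
  [104,17], [104,17,33], [104,17,32], [97,25], [97,25,40], [97,25,32], [97,9,16], [97,9,16,32],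
  [224], [32,192], [35,195], [47,207], [48,208], [51,211], [63,223], [225], [225,32], [33,192],
  [225,44], [45,204], [225,48], [49,208], [225,60], [61,220], [3,224], [33,193], [3,32,192],
  [45,205], [3,44,204], [49,209], [3,48,208], [61,221], [3,60,220], [225,1], [33,1,192], [45,1,204],
  [49,1,208], [61,1,220], [230], [230,39], [230,55], [229,3], [197,32], [33,196], [229,3,36],
  [213,48], [49,212], [229,3,52], [228,3], [33,197], [196,3,32], [37,193], [228,3,36], [49,213],
  [212,3,48], [53,209], [228,3,52], [228,1], [33,196,1], [37,192,1], [49,212,1], [53,208,1],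
  [15,227], [15,32,195], [15,48,211], [230,5], [231,7], [199,7,32], [196,7,35], [215,7,48],
  [212,7,51], [225,5], [37,193,5], [53,209,5], [3,12,224], [37,197], [196,3,36], [3,12,32,192],
  [53,213], [212,3,52], [3,12,48,208], [229,3,5], [33,196,5], [37,192,5], [49,212,5], [53,208,5],
  [228,3,4], [33,197,4], [196,3,4,32], [49,213,4], [212,3,4,48], [225,4,1], [33,196,1,4],
  [49,212,1,4], [240], [48,192], [51,195], [60,204], [63,207], [16,224], [16,32,192], [16,35,195],
  [16,47,207], [19,227], [19,32,195], [19,35,192], [19,44,207], [19,47,204], [31,239], [31,32,207],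
  [31,35,204], [31,44,195], [241], [241,48], [49,192], [241,60], [61,204], [241,32], [33,208],
  [241,44], [45,220], [225,16], [225,16,32], [33,16,192], [225,16,44], [45,16,204], [241,17],
  [49,17,192], [33,17,193], [61,17,204], [45,17,205], [237,28], [237,28,32], [33,28,204],
  [237,28,44], [45,28,192], [241,29], [61,29,204], [33,29,205], [49,29,192], [45,29,193], [3,240],
  [49,193], [3,48,192], [61,205], [3,60,204], [33,209], [3,32,208], [45,221], [3,44,220], [225,17],
  [33,17,192], [49,17,193], [45,17,204], [61,17,205], [3,16,224], [33,16,193], [3,16,32,192],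
  [45,16,205], [3,16,44,204], [237,29], [33,29,204], [61,29,205], [45,29,192], [49,29,193],
  [3,28,236], [33,28,205], [3,28,32,204], [45,28,193], [3,28,44,192], [241,1], [49,1,192],
  [61,1,204], [33,1,208], [45,1,220], [225,1,16], [33,1,16,192], [45,1,16,204], [237,1,28],
  [33,1,28,204], [45,1,28,192], [246], [246,55], [230,16], [230,16,39], [229,19], [229,19,39],
  [246,21], [245,3], [197,48], [49,196], [245,3,52], [53,192], [229,3,16], [197,32,16], [33,196,16],
  [229,3,16,36], [228,17], [49,196,17], [33,197,17], [53,192,17], [37,193,17], [245,3,21],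
  [53,192,21], [33,212,21], [37,197,21], [244,3], [49,197], [196,3,48], [53,193], [244,3,52],
  [33,213], [212,3,32], [37,209], [244,3,36], [229,17], [33,196,17], [49,197,17], [37,192,17],
  [53,193,17], [228,3,16], [33,197,16], [196,3,16,32], [37,193,16], [228,3,16,36], [225,21],
  [33,213,21], [53,193,21], [37,196,21], [49,197,21], [244,3,20], [33,213,20], [212,3,20,32],
  [37,197,20], [196,3,20,36], [244,1], [49,196,1], [53,192,1], [33,212,1], [37,208,1], [228,1,16],
  [33,196,1,16], [37,192,1,16], [225,20,1], [33,212,1,20], [37,196,1,20], [15,243], [15,48,195],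
  [230,21], [15,16,227], [15,16,32,195], [15,19,224], [15,19,32,192], [246,5], [230,5,16],
  [229,5,19], [247,7], [199,7,48], [196,7,51], [215,7,32], [212,7,35], [231,7,16], [199,7,16,32],
  [196,7,16,35], [228,7,19], [196,7,19,32], [199,7,19,35], [241,5], [53,193,5], [49,197,5],
  [225,5,16], [37,193,5,16], [229,17,5], [37,192,5,17], [33,196,5,17], [3,12,240], [53,197],
  [196,3,52], [49,12,193], [3,12,48,192], [229,3,21], [37,192,21], [49,212,21], [33,196,21],
  [228,3,20], [37,193,20], [212,3,20,36], [33,197,20], [196,3,20,32], [3,12,16,224], [37,197,16],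
  [196,3,16,36], [3,12,16,32,192], [245,3,5], [49,196,5], [53,192,5], [225,5,17], [33,197,5,17],
  [229,3,5,16], [33,196,5,16], [37,192,5,16], [244,3,4], [49,197,4], [196,3,4,48], [33,213,4],
  [212,3,4,32], [225,4,17], [33,196,4,17], [49,197,4,17], [228,3,4,16], [33,197,4,16],
  [196,3,4,16,32], [241,4,1], [49,196,1,4], [225,4,1,16], [33,196,1,4,16], [352], [368], [224,512],
  [240,528], [352,64], [368,64], [367,79], [383,79], [368,80], [352,80], [383,95], [367,95],
  [355,15], [371,15], [518,224], [15,227,517], [229,515], [534,240], [15,243,533], [245,531],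
  [355,15,64], [229,64], [371,15,64], [245,64], [371,15,80], [229,80], [355,15,80], [245,80], [356],
  [372], [230,515], [534,243], [645,240], [246,531], [356,71], [354,71], [372,71], [370,71],
  [372,87], [370,87], [356,87], [354,87], [518,3,224], [229,3,512], [534,3,240], [245,3,528],
  [353,6], [369,6], [246,6,531], [354,6,65], [370,6,65], [353,66], [369,66], [370,6,81], [354,6,81],
  [369,82], [353,82], [229,513], [245,529], [355,6], [371,6], [245,6,531], [67,227], [67,243],
  [229,64,6], [245,64,6], [83,227], [83,243], [229,80,6], [245,80,6], [353,3], [352,3], [369,3],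
  [368,3], [229,3,5,512], [241,529], [245,3,5,528], [66,225], [353,3,65], [66,241], [369,3,65],
  [353,64], [67,224,3], [369,64], [67,240,3], [82,225], [369,3,81], [82,241], [353,3,81], [369,80],
  [83,224,3], [353,80], [83,240,3], [353,1], [369,1], [225,512,1], [241,528,1], [353,1,64],
  [369,1,64], [369,1,80], [353,1,80], [352,16], [16,224,512], [352,16,64], [367,16,79], [358,31],
  [31,224,527], [361,31,70], [358,31,73], [355,15,16], [518,16,224], [15,16,227,517], [229,16,515],
  [355,15,16,64], [229,64,16], [534,19,224], [518,19,227], [229,19,512], [230,19,515], [352,22],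
  [246,22,512], [246,64,22], [230,64,22], [230,19,512], [356,16], [230,16,515], [356,16,71],
  [354,16,71], [359,22], [359,22,71], [353,22,71], [518,3,16,224], [229,3,16,512], [245,3,21,512],
  [229,3,21,517], [353,6,16], [354,6,16,65], [353,66,16], [352,19], [83,224,19], [67,224,19],
  [229,513,16], [369,17], [353,17], [229,529,17], [225,513,17], [369,17,64], [353,17,64],
  [353,17,65], [369,17,65], [354,19], [354,19,66], [353,19,65], [355,6,16], [67,227,16],
  [229,64,6,16], [353,3,16], [352,3,16], [229,3,5,16,512], [66,225,16], [353,3,16,65], [353,64,16],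
  [67,224,3,16], [353,1,16], [225,512,1,16], [353,1,16,64], [96,224], [111,227], [106,230],
  [105,3,224], [97,224], [112,224], [121,236], [111,243], [106,246], [105,241], [105,19,224],
  [97,240], [288,32], [288,44], [292,39], [111,195], [289,33], [105,197], [289,32], [304,48],
  [304,60], [112,192], [115,195], [124,204], [127,207], [308,55], [292,55], [111,211], [111,195,16],
  [305,49], [289,49], [305,32], [105,213], [289,48], [105,197,16], [305,48], [289,32,16]]

/-- Runs through a list of generating sets, with `prev` the preceding bit mask and `acc` the total
number of conjugates so far. -/
def checkRepresentatives : List (List ℕ) → ℕ → ℕ → Bool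
  | [], _, acc => Nat.beq acc 9417
  | gens :: l, prev, acc =>
    gens.all (fun g => Nat.blt g 768) && force (closureMask gens) fun m =>
      Nat.blt prev m && match orbit [conjSwap, conjCycle] m with
        | none => false
        | some o => o.all (Nat.ble m) &&
            force (Nat.add o.length acc) (checkRepresentatives l m)

/-! ### Enumeration of the data determining a subgroup -/

/-- Tuples `(a, b, k, l, m)` such that `perm a` and `perm b` generate the 30 groups of permutations
of four letters, with `k`, `l`, `m` the orders of `perm a`, `perm b` and their product. -/
def generatingPairs : List (ℕ × ℕ × ℕ × ℕ × ℕ) :=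
  [(0, 0, 1, 1, 1), (1, 0, 2, 1, 2), (2, 0, 2, 1, 2), (3, 0, 3, 1, 3), (4, 0, 2, 1, 2), (6, 0, 2, 1,
   2), (7, 0, 2, 1, 2), (8, 0, 3, 1, 3), (9, 0, 4, 1, 4), (10, 0, 3, 1, 3), (11, 0, 4, 1, 4), (12,
   0, 2, 1, 2), (13, 0, 3, 1, 3), (16, 0, 2, 1, 2), (17, 0, 4, 1, 4), (18, 0, 2, 1, 2), (20, 0, 2,
   1, 2), (1, 2, 2, 2, 3), (1, 6, 2, 2, 2), (1, 8, 2, 3, 4), (1, 12, 2, 2, 3), (1, 16, 2, 2, 4), (2,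
   6, 2, 2, 3), (2, 7, 2, 2, 4), (2, 18, 2, 2, 2), (3, 7, 3, 2, 3), (4, 6, 2, 2, 3), (4, 7, 2, 2,
   4), (4, 12, 2, 2, 2), (7, 16, 2, 2, 2)]

/-- The subspaces of the vectors with digits below `j`: the positions of the leading digits as a bit
mask, the elements of the reduced basis, and all elements. -/
def subspaces : ℕ → List (ℕ × List ℕ × List ℕ)
  | 0 => [(0, [], [0])]
  | j + 1 => (subspaces j).flatMap fun s => s ::
      ((List.range' (2 ^ j) (2 ^ j)).filter fun x => Nat.beq (Nat.land x s.1) 0).map fun x =>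
        (Nat.lor s.1 (2 ^ j), x :: s.2.1, s.2.2 ++ s.2.2.map (Nat.xor x))

/-- The bit mask of a list of numbers. -/
def toMask (l : List ℕ) : ℕ := l.foldr (fun x m => Nat.lor (Nat.shiftLeft 1 x) m) 0

/-- Powers in the numbering `elt`. -/
def pow (x : ℕ) : ℕ → ℕ
  | 0 => 0
  | k + 1 => force (pow x k) fun y => mul y x

/-- Candidates for the pairs `(v, w)` such that `(v, perm a)` and `(w, perm b)` lie in a subgroup
with given projection to the permutations and given intersection with the vectors. -/
def lifts (P M : ℕ) (B : List ℕ) (p : ℕ × ℕ × ℕ × ℕ × ℕ) : List (ℕ × ℕ) :=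
  bif B.all fun s => bit M (act p.1 s) && bit M (act p.2.1 s) then
    let reduced (a k : ℕ) : List ℕ := (List.range 32).filter fun v =>
      Nat.beq (Nat.land v P) 0 && force (Nat.add (Nat.mul 32 a) v) fun x => bit M (pow x k)
    forceList (reduced p.1 p.2.2.1) fun vs => forceList (reduced p.2.1 p.2.2.2.1) fun ws =>
      vs.flatMap fun v => (ws.filter fun w =>
        force (mul (Nat.add (Nat.mul 32 p.1) v) (Nat.add (Nat.mul 32 p.2.1) w)) fun x =>
          bit M (pow x p.2.2.2.2)).map fun w => (v, w)
  else []

/-- `lifts` for a given subspace. -/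
def subspaceLifts (s : ℕ × List ℕ × List ℕ) (p : ℕ × ℕ × ℕ × ℕ × ℕ) : List (ℕ × ℕ) :=
  lifts s.1 (toMask s.2.2) s.2.1 p

/-! ### Correctness of the numerical model -/

theorem perm_permMul : ∀ q < 24, ∀ r < 24,
    permMul q r < 24 ∧ perm (permMul q r) = perm q * perm r := by
  decide +kernel

theorem vec_act : ∀ q < 24, ∀ v < 32,
    act q v < 32 ∧ vec (act q v) = whittenHom 4 (perm q) (vec v) := by
  decide +kernel

theorem exists_perm : ∀ p, ∃ q < 24, perm q = p := by
  decide +kernel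

theorem exists_vec : ∀ x, ∃ v < 32, vec v = x := by
  decide +kernel

theorem vec_xor (v w : ℕ) : vec (v ^^^ w) = vec v * vec w := by
  funext o
  simp only [vec, Nat.testBit_xor, Pi.mul_apply]
  cases v.testBit _ <;> cases w.testBit _ <;> rfl

theorem elt_add {q v : ℕ} (hv : v < 32) : elt (32 * q + v) = ⟨vec v, perm q⟩ := by
  have h₁ : (32 * q + v) % 32 = v := by omega
  have h₂ : (32 * q + v) / 32 = q := by omega
  rw [elt, h₁, h₂]

theorem mul_add {q r v w : ℕ} (hv : v < 32) (hw : w < 32) :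
    mul (32 * q + v) (32 * r + w) = 32 * permMul q r + (v ^^^ act q w) := by
  have h₁ : (32 * q + v) % 32 = v := by omega
  have h₂ : (32 * q + v) / 32 = q := by omega
  have h₃ : (32 * r + w) % 32 = w := by omega
  have h₄ : (32 * r + w) / 32 = r := by omega
  change 32 * permMul ((32 * q + v) / 32) ((32 * r + w) / 32) +
    ((32 * q + v) % 32 ^^^ act ((32 * q + v) / 32) ((32 * r + w) % 32)) = _
  rw [h₁, h₂, h₃, h₄]

theorem exists_eq_add {i : ℕ} (hi : i < 768) : ∃ q v, q < 24 ∧ v < 32 ∧ i = 32 * q + v :=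
  ⟨i / 32, i % 32, by omega, by omega, by omega⟩

theorem xor_act_lt {q v w : ℕ} (hq : q < 24) (hv : v < 32) (hw : w < 32) : v ^^^ act q w < 32 :=
  Nat.xor_lt_two_pow (n := 5) hv (vec_act q hq w hw).1

theorem mul_lt {i j : ℕ} (hi : i < 768) (hj : j < 768) : mul i j < 768 := by
  obtain ⟨q, v, hq, hv, rfl⟩ := exists_eq_add hi
  obtain ⟨r, w, hr, hw, rfl⟩ := exists_eq_add hj
  rw [mul_add hv hw]
  have := (perm_permMul q hq r hr).1
  have := xor_act_lt hq hv hw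
  omega

theorem elt_mul {i j : ℕ} (hi : i < 768) (hj : j < 768) : elt (mul i j) = elt i * elt j := by
  obtain ⟨q, v, hq, hv, rfl⟩ := exists_eq_add hi
  obtain ⟨r, w, hr, hw, rfl⟩ := exists_eq_add hj
  rw [mul_add hv hw, elt_add hv, elt_add hw, elt_add (xor_act_lt hq hv hw), vec_xor,
    (vec_act q hq w hw).2, (perm_permMul q hq r hr).2]
  rfl

theorem elt_zero : elt 0 = 1 :=
  SemidirectProduct.ext (by decide +kernel : vec 0 = 1) (by decide +kernel : perm 0 = 1)

theorem exists_elt (x : WhittenGroup 4) : ∃ i < 768, elt i = x := by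
  obtain ⟨v, hv, h⟩ := exists_vec x.left
  obtain ⟨q, hq, h'⟩ := exists_perm x.right
  exact ⟨32 * q + v, by omega, by rw [elt_add hv, h, h']⟩

theorem card_whittenGroup : Nat.card (WhittenGroup 4) = 768 := by
  rw [SemidirectProduct.card, Nat.card_eq_fintype_card, Nat.card_eq_fintype_card,
    Fintype.card_perm, Fintype.card_fun]
  rfl

instance : Finite (WhittenGroup 4) :=
  Nat.finite_of_card_ne_zero (by rw [card_whittenGroup]; norm_num)

theorem elt_injOn {i j : ℕ} (hi : i < 768) (hj : j < 768) (h : elt i = elt j) : i = j := by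
  have hs : Function.Surjective fun k : Fin 768 => elt k := fun x =>
    let ⟨i, hi, h⟩ := exists_elt x
    ⟨⟨i, hi⟩, h⟩
  have hb : Function.Bijective fun k : Fin 768 => elt k :=
    (Nat.bijective_iff_surjective_and_card _).2 ⟨hs, by rw [Nat.card_fin, card_whittenGroup]⟩
  simpa using @hb.1 ⟨i, hi⟩ ⟨j, hj⟩ h

theorem bit_eq_testBit (m i : ℕ) : bit m i = m.testBit i := by
  rw [Bool.eq_iff_iff, bit, Nat.beq_eq, Nat.testBit]
  change (m >>> i) &&& 1 = 1 ↔ _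
  rw [Nat.and_one_is_mod, Nat.one_and_eq_mod_two]
  rcases Nat.mod_two_eq_zero_or_one (m >>> i) with h | h <;> simp [h]

@[simp]
theorem force_eq {α : Type*} (n : ℕ) (k : ℕ → α) : force n k = k n := by
  cases n <;> rfl

@[simp]
theorem forceList_eq {α : Type*} (l : List ℕ) (k : List ℕ → α) : forceList l k = k l := by
  induction l generalizing k with
  | nil => rfl
  | cons a l ih => simp [forceList, ih]

theorem tag_shiftRight (n : ℕ) : Nat.shiftRight (tag n) 64 = n := by
  change ((n <<< 64) ||| (n % 18446744073709551557)) >>> 64 = n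
  rw [Nat.shiftRight_or_distrib, Nat.shiftLeft_shiftRight,
    Nat.shiftRight_eq_div_pow (n % 18446744073709551557), Nat.div_eq_of_lt, Nat.or_zero]
  exact (Nat.mod_lt _ (by norm_num)).trans (by norm_num)

@[simp]
theorem forceTag_eq {α : Type*} (n : ℕ) (k : ℕ → α) : forceTag n k = k n := by
  rw [forceTag, force_eq, tag_shiftRight]

/-! ### Correctness of the search -/

section Search

variable {σ : Type} {mem : σ → ℕ → Bool} {ins : σ → ℕ → (σ → Option σ) → Option σ}
  {insert : σ → ℕ → σ} {Inv : σ → Prop}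

theorem exists_expand_eq (hins : ∀ s y k, ins s y k = k (insert s y))
    (hmem : ∀ s y z, mem (insert s y) z = true ↔ z = y ∨ mem s z = true)
    (hInv : ∀ s y, mem s y = false → Inv s → Inv (insert s y))
    (x : ℕ) (fs : List (ℕ → ℕ)) (todo : List ℕ) (s : σ) (k : List ℕ → σ → Option σ) (hs : Inv s) :
    ∃ todo' s', expand mem ins x fs todo s k = k todo' s' ∧ Inv s' ∧
      (∀ z, mem s' z = true ↔ mem s z = true ∨ ∃ f ∈ fs, f x = z) ∧ (∀ z ∈ todo, z ∈ todo') ∧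
      (∀ z ∈ todo', z ∈ todo ∨ mem s' z = true) ∧
      (∀ z, mem s' z = true → mem s z = true ∨ z ∈ todo') := by
  induction fs generalizing todo s with
  | nil => exact ⟨todo, s, rfl, hs, by simp, by simp, by tauto, by tauto⟩
  | cons f fs ih =>
    rw [expand, force_eq]
    cases h : mem s (f x)
    · rw [cond_false, hins]
      obtain ⟨todo', s', h₁, h₂, h₃, h₄, h₅, h₆⟩ :=
        ih (f x :: todo) (insert s (f x)) (hInv _ _ h hs)
      refine ⟨todo', s', h₁, h₂, fun z => ?_, fun z hz => h₄ z (by simp [hz]), fun z hz => ?_,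
        fun z hz => ?_⟩
      · rw [h₃, hmem, List.exists_mem_cons_iff]
        grind
      · rcases h₅ z hz with hz | hz
        · rcases List.mem_cons.1 hz with rfl | hz
          · exact .inr ((h₃ _).2 (.inl ((hmem _ _ _).2 (.inl rfl))))
          · exact .inl hz
        · exact .inr hz
      · rcases h₆ z hz with hz | hz
        · rcases (hmem _ _ _).1 hz with rfl | hz
          · exact .inr (h₄ _ (by simp))
          · exact .inl hz
        · exact .inr hz
    · rw [cond_true]
      obtain ⟨todo', s', h₁, h₂, h₃, h₄, h₅, h₆⟩ := ih todo s hs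
      refine ⟨todo', s', h₁, h₂, fun z => ?_, h₄, h₅, h₆⟩
      rw [h₃, List.exists_mem_cons_iff]
      grind

theorem search_eq_some (hins : ∀ s y k, ins s y k = k (insert s y))
    (hmem : ∀ s y z, mem (insert s y) z = true ↔ z = y ∨ mem s z = true)
    (hInv : ∀ s y, mem s y = false → Inv s → Inv (insert s y))
    (fs : List (ℕ → ℕ)) (n : ℕ) (todo : List ℕ) (s r : σ)
    (h : search mem ins fs n todo s = some r) (hs : Inv s)
    (htodo : ∀ z ∈ todo, mem s z = true)
    (hseen : ∀ z, mem s z = true → z ∈ todo ∨ ∀ f ∈ fs, mem s (f z) = true) :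
    Inv r ∧ (∀ z, mem s z = true → mem r z = true) ∧
      (∀ z, mem r z = true → ∀ f ∈ fs, mem r (f z) = true) ∧
      ∀ Q : ℕ → Prop, (∀ z, mem s z = true → Q z) → (∀ f ∈ fs, ∀ z, Q z → Q (f z)) →
        ∀ z, mem r z = true → Q z := by
  induction n generalizing todo s with
  | zero => simp [search] at h
  | succ n ih =>
    cases todo with
    | nil =>
      obtain rfl : s = r := by simpa [search] using h
      exact ⟨hs, fun _ h => h, fun z hz => (hseen z hz).resolve_left (by simp), fun Q h _ => h⟩
    | cons x todo =>
      rw [search] at h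
      obtain ⟨todo', s', h₁, h₂, h₃, h₄, h₅, h₆⟩ :=
        exists_expand_eq hins hmem hInv x fs todo s (search mem ins fs n) hs
      rw [h₁] at h
      obtain ⟨i₁, i₂, i₃, i₄⟩ := ih todo' s' h h₂
        (fun z hz => (h₅ z hz).elim (fun hz => (h₃ z).2 (.inl (htodo z (by simp [hz])))) id)
        (fun z hz => by
          rcases h₆ z hz with hz | hz
          · rcases hseen z hz with hz | hz
            · rcases List.mem_cons.1 hz with rfl | hz
              · exact .inr fun f hf => (h₃ _).2 (.inr ⟨f, hf, rfl⟩)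
              · exact .inl (h₄ z hz)
            · exact .inr fun f hf => (h₃ _).2 (.inl (hz f hf))
          · exact .inl hz)
      refine ⟨i₁, fun z hz => i₂ z ((h₃ z).2 (.inl hz)), i₃,
        fun Q hQ hf => i₄ Q (fun z hz => ?_) hf⟩
      rcases (h₃ z).1 hz with hz | ⟨f, hf', rfl⟩
      · exact hQ z hz
      · exact hf f hf' x (hQ x (htodo x (by simp)))

end Search

/-- The bit mask `m` describes the subgroup `H`. -/
def IsMask (m : ℕ) (H : Subgroup (WhittenGroup 4)) : Prop :=
  ∀ i, m.testBit i = true ↔ i < 768 ∧ elt i ∈ H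

theorem closureMask_spec {gens : List ℕ} (hg : ∀ g ∈ gens, g < 768) (h : closureMask gens ≠ 0) :
    IsMask (closureMask gens) (Subgroup.closure {x | ∃ g ∈ gens, elt g = x}) := by
  cases hr : search bit (fun m y k => force (Nat.lor m (Nat.shiftLeft 1 y)) k)
    (gens.map fun s x => mul x s) 769 [0] 1 with
  | none => exact absurd (by rw [closureMask, hr]; rfl) h
  | some r =>
    rw [closureMask, hr, Option.getD_some]
    have one (z) : bit 1 z = true ↔ z = 0 := by
      rw [bit_eq_testBit, ← pow_zero 2, Nat.testBit_two_pow]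
      simp [eq_comm]
    obtain ⟨-, h₁, h₂, h₃⟩ := search_eq_some (insert := fun m y => m ||| 1 <<< y)
      (Inv := fun _ => True) (fun _ _ _ => force_eq _ _)
      (fun s y z => by
        rw [bit_eq_testBit, bit_eq_testBit, Nat.testBit_or, Nat.one_shiftLeft, Nat.testBit_two_pow,
          Bool.or_eq_true, decide_eq_true_iff, or_comm, eq_comm])
      (fun _ _ _ _ => trivial) _ _ _ _ _ hr trivial (by simp [one])
      (fun z hz => .inl (by simpa using (one z).1 hz))
    simp only [List.mem_map, forall_exists_index, and_imp, forall_apply_eq_imp_iff₂] at h₂ h₃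
    simp only [bit_eq_testBit] at one h₁ h₂ h₃
    have lt (i) (hi : r.testBit i = true) : i < 768 :=
      h₃ (· < 768) (fun z hz => by rw [(one z).1 hz]; norm_num)
        (fun g hg' z hz => mul_lt hz (hg g hg')) i hi
    intro i
    refine ⟨fun hi => ⟨lt i hi, ?_⟩, fun ⟨hi, hm⟩ => ?_⟩
    · refine (h₃ (fun i => i < 768 ∧ elt i ∈ _) (fun z hz => ?_) (fun g hg' z hz => ?_) i hi).2
      · rw [(one z).1 hz, elt_zero]
        exact ⟨by norm_num, one_mem _⟩
      · rw [elt_mul hz.1 (hg g hg')]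
        exact ⟨mul_lt hz.1 (hg g hg'), mul_mem hz.2 (Subgroup.subset_closure ⟨g, hg', rfl⟩)⟩
    · suffices ∀ x ∈ Subgroup.closure {x | ∃ g ∈ gens, elt g = x},
          ∃ i, r.testBit i = true ∧ elt i = x by
        obtain ⟨j, hj, e⟩ := this _ hm
        rwa [← elt_injOn (lt j hj) hi e]
      intro x hx
      rw [← Subgroup.mem_toSubmonoid, Subgroup.closure_toSubmonoid_of_finite] at hx
      induction hx using Submonoid.closure_induction_right with
      | one => exact ⟨0, h₁ 0 ((one 0).2 rfl), elt_zero⟩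
      | mul_right x hx y hy ih =>
        obtain ⟨i, hi, rfl⟩ := ih
        obtain ⟨g, hg', rfl⟩ := hy
        exact ⟨mul i g, h₂ i hi g hg', elt_mul (lt i hi) (hg g hg')⟩

theorem IsMask.eq {m n : ℕ} {H : Subgroup (WhittenGroup 4)} (hm : IsMask m H) (hn : IsMask n H) :
    m = n :=
  Nat.eq_of_testBit_eq fun i => Bool.eq_iff_iff.2 ((hm i).trans (hn i).symm)

theorem IsMask.subgroup_eq {m : ℕ} {H K : Subgroup (WhittenGroup 4)} (hH : IsMask m H)
    (hK : IsMask m K) : H = K := by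
  ext x
  obtain ⟨i, hi, rfl⟩ := exists_elt x
  simpa [hi] using (hH i).symm.trans (hK i)

theorem IsMask.ne_zero {m : ℕ} {H : Subgroup (WhittenGroup 4)} (h : IsMask m H) : m ≠ 0 := by
  rintro rfl
  simpa [elt_zero, one_mem] using h 0

/-! ### Correctness of the conjugation of bit masks -/

/-- The digits of `Φ m` come from the digits of `m`. -/
def IsBitwise (Φ : ℕ → ℕ) : Prop :=
  ∀ m j, (Φ m).testBit j = true ↔ ∃ i, m.testBit i = true ∧ (Φ (2 ^ i)).testBit j = true

theorem IsBitwise.comp {Φ Ψ : ℕ → ℕ} (hΦ : IsBitwise Φ) (hΨ : IsBitwise Ψ) :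
    IsBitwise fun m => Φ (Ψ m) := by
  intro m j
  rw [hΦ]
  simp only [hΨ m, hΦ (Ψ (2 ^ _))]
  grind

theorem IsBitwise.lor {Φ Ψ : ℕ → ℕ} (hΦ : IsBitwise Φ) (hΨ : IsBitwise Ψ) :
    IsBitwise fun m => Nat.lor (Φ m) (Ψ m) := by
  intro m j
  change (Φ m ||| Ψ m).testBit j = true ↔
    ∃ i, m.testBit i = true ∧ (Φ (2 ^ i) ||| Ψ (2 ^ i)).testBit j = true
  simp only [Nat.testBit_or, Bool.or_eq_true]
  rw [hΦ m, hΨ m]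
  grind

theorem isBitwise_zero : IsBitwise fun _ => 0 := by
  simp [IsBitwise]

theorem isBitwise_land (p : ℕ) : IsBitwise fun m => Nat.land m p := by
  intro m j
  change (m &&& p).testBit j = true ↔ ∃ i, m.testBit i = true ∧ (2 ^ i &&& p).testBit j = true
  simp [Nat.testBit_two_pow]

theorem isBitwise_shiftLeft (k : ℕ) : IsBitwise fun m => Nat.shiftLeft m k := by
  intro m j
  change (m <<< k).testBit j = true ↔ ∃ i, m.testBit i = true ∧ (2 ^ i <<< k).testBit j = true
  simp [Nat.testBit_shiftLeft, Nat.testBit_two_pow, and_comm]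

theorem isBitwise_shiftRight (k : ℕ) : IsBitwise fun m => Nat.shiftRight m k := by
  intro m j
  change (m >>> k).testBit j = true ↔ ∃ i, m.testBit i = true ∧ (2 ^ i >>> k).testBit j = true
  simp [Nat.testBit_shiftRight, Nat.testBit_two_pow]

theorem isBitwise_shiftLayer (L R : List (ℕ × ℕ)) : IsBitwise (shiftLayer L R) := by
  refine .lor ?_ ?_
  · induction L with
    | nil => exact isBitwise_zero
    | cons p L ih => exact .lor (.comp (isBitwise_shiftLeft _) (isBitwise_land _)) ih
  · induction R with
    | nil => exact isBitwise_zero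
    | cons p R ih => exact .lor (.comp (isBitwise_shiftRight _) (isBitwise_land _)) ih

theorem isBitwise_conjSwap : IsBitwise conjSwap := by
  have : conjSwap = fun m => swapBlocks (swapBits m) := funext fun m => forceTag_eq _ _
  rw [this]
  exact .comp (isBitwise_shiftLayer _ _) (isBitwise_shiftLayer _ _)

theorem isBitwise_conjCycle : IsBitwise conjCycle := by
  have : conjCycle = fun m => shear (cycleBlocks (cycleBits m)) :=
    funext fun m => by rw [conjCycle, forceTag_eq, forceTag_eq]
  rw [this]
  exact .comp (isBitwise_shiftLayer _ _)
    (.comp (isBitwise_shiftLayer _ _) (isBitwise_shiftLayer _ _))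

/-- The image of a subgroup under conjugation. -/
abbrev conjSubgroup (x : WhittenGroup 4) (H : Subgroup (WhittenGroup 4)) :
    Subgroup (WhittenGroup 4) :=
  H.map (MulAut.conj x).toMonoidHom

theorem conjSubgroup_one (H : Subgroup (WhittenGroup 4)) : conjSubgroup 1 H = H := by
  simp [conjSubgroup, Subgroup.ext_iff]

theorem conjSubgroup_mul (x y : WhittenGroup 4) (H : Subgroup (WhittenGroup 4)) :
    conjSubgroup (x * y) H = conjSubgroup x (conjSubgroup y H) := by
  simp [conjSubgroup, Subgroup.map_map, MulAut.mul_def, ← MulEquiv.coe_monoidHom_trans]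

theorem IsMask.conj {Φ : ℕ → ℕ} (hΦ : IsBitwise Φ) {g g' : ℕ} (hg : g < 768) (hg' : g' < 768)
    (h : mul g g' = 0) (hc : ∀ i < 768, Φ (2 ^ i) = 2 ^ mul (mul g i) g') {m : ℕ}
    {H : Subgroup (WhittenGroup 4)} (hm : IsMask m H) :
    IsMask (Φ m) (conjSubgroup (elt g) H) := by
  have hinv : elt g' = (elt g)⁻¹ := by
    rw [eq_comm, inv_eq_iff_mul_eq_one, ← elt_mul hg hg', h, elt_zero]
  have he (i) (hi : i < 768) : elt (mul (mul g i) g') = elt g * elt i * (elt g)⁻¹ := by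
    rw [elt_mul (mul_lt hg hi) hg', elt_mul hg hi, hinv]
  intro j
  rw [hΦ m j]
  constructor
  · rintro ⟨i, hi, hj⟩
    obtain ⟨hi, hi'⟩ := (hm i).1 hi
    rw [hc i hi, Nat.testBit_two_pow, decide_eq_true_iff] at hj
    subst hj
    exact ⟨mul_lt (mul_lt hg hi) hg', elt i, hi', (he i hi).symm⟩
  · rintro ⟨hj, x, hx, hxj⟩
    obtain ⟨i, hi, rfl⟩ := exists_elt x
    refine ⟨i, (hm i).2 ⟨hi, hx⟩, ?_⟩
    rw [hc i hi, Nat.testBit_two_pow, decide_eq_true_iff]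
    refine elt_injOn (mul_lt (mul_lt hg hi) hg') hj ((he i hi).trans ?_)
    simpa using hxj

theorem IsMask.conjSwap {m : ℕ} {H : Subgroup (WhittenGroup 4)} (hm : IsMask m H) :
    IsMask (conjSwap m) (conjSubgroup (elt 32) H) :=
  hm.conj isBitwise_conjSwap (g' := 32) (by norm_num) (by norm_num) (by decide +kernel)
    (by decide +kernel)

theorem IsMask.conjCycle {m : ℕ} {H : Subgroup (WhittenGroup 4)} (hm : IsMask m H) :
    IsMask (conjCycle m) (conjSubgroup (elt 257) H) :=
  hm.conj isBitwise_conjCycle (g' := 449) (by norm_num) (by norm_num) (by decide +kernel)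
    (by decide +kernel)

theorem closure_generators :
    Subgroup.closure {x | ∃ g ∈ [32, 257, 16], elt g = x} = (⊤ : Subgroup (WhittenGroup 4)) := by
  rw [eq_top_iff]
  rintro x -
  obtain ⟨i, hi, rfl⟩ := exists_elt x
  have h : closureMask [32, 257, 16] ≠ 0 ∧
    ∀ i < 768, bit (closureMask [32, 257, 16]) i = true := by decide +kernel
  exact ((closureMask_spec (by simp) h.1 i).1 (by rw [← bit_eq_testBit, h.2 i hi])).2

theorem conjSubgroup_elt_sixteen (H : Subgroup (WhittenGroup 4)) : conjSubgroup (elt 16) H = H := by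
  have h : elt 16 ∈ Subgroup.center (WhittenGroup 4) := by
    rw [Subgroup.mem_center_iff]
    intro x
    obtain ⟨i, hi, rfl⟩ := exists_elt x
    have h : ∀ i < 768, mul i 16 = mul 16 i := by decide +kernel
    rw [← elt_mul hi (by norm_num), ← elt_mul (by norm_num) hi, h i hi]
  ext x
  simp [conjSubgroup, (Subgroup.mem_center_iff.1 h _).symm]

theorem orbit_spec {m : ℕ} {o : List ℕ} {H : Subgroup (WhittenGroup 4)} (hm : IsMask m H)
    (ho : orbit [conjSwap, conjCycle] m = some o) :
    o.Nodup ∧ ∀ n, n ∈ o ↔ ∃ x, IsMask n (conjSubgroup x H) := by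
  rw [orbit, force_eq, Option.map_eq_some_iff] at ho
  obtain ⟨r, hr, rfl⟩ := ho
  have any_iff (l : List ℕ) (y : ℕ) : l.any (Nat.beq y) = true ↔ y ∈ l := by
    simp only [List.any_eq_true, Nat.beq_eq, exists_eq_right']
  obtain ⟨hd, h₁, h₂, h₃⟩ := search_eq_some (insert := fun l y => y :: l) (Inv := List.Nodup)
    (fun _ _ _ => rfl) (fun s y z => by simp only [any_iff, List.mem_cons])
    (fun s y h hs => List.nodup_cons.2 ⟨fun hy => by simp [(any_iff s y).2 hy] at h, hs⟩)
    _ _ _ _ _ hr (by simp) (by simp) (fun z hz => .inl ((any_iff _ _).1 hz))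
  simp only [any_iff, List.mem_map, List.mem_singleton, forall_exists_index, and_imp,
    forall_apply_eq_imp_iff₂, forall_eq] at h₁ h₂ h₃
  have hQ := h₃ (fun K => K = tag (Nat.shiftRight K 64) ∧
    ∃ x, IsMask (Nat.shiftRight K 64) (conjSubgroup x H))
    (by rw [tag_shiftRight]; exact ⟨rfl, 1, by rwa [conjSubgroup_one]⟩)
    (by
      simp only [tag_shiftRight, true_and, List.mem_cons, List.not_mem_nil, or_false]
      rintro f (rfl | rfl) z ⟨-, x, hx⟩
      · exact ⟨elt 32 * x, by rw [conjSubgroup_mul]; exact hx.conjSwap⟩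
      · exact ⟨elt 257 * x, by rw [conjSubgroup_mul]; exact hx.conjCycle⟩)
  have hr' (f) (hf : f ∈ [conjSwap, conjCycle]) (n) (hn : n ∈ r.map (Nat.shiftRight · 64)) :
      f n ∈ r.map (Nat.shiftRight · 64) := by
    obtain ⟨K, hK, rfl⟩ := List.mem_map.1 hn
    exact List.mem_map.2 ⟨_, h₂ K hK f hf, tag_shiftRight _⟩
  refine ⟨hd.map_on fun x hx y hy e => by rw [(hQ x hx).1, e, ← (hQ y hy).1], fun n => ⟨?_, ?_⟩⟩
  · intro hn
    obtain ⟨K, hK, rfl⟩ := List.mem_map.1 hn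
    exact (hQ K hK).2
  · suffices ∀ x K n, n ∈ r.map (Nat.shiftRight · 64) → IsMask n K →
        ∃ n' ∈ r.map (Nat.shiftRight · 64), IsMask n' (conjSubgroup x K) by
      rintro ⟨x, hx⟩
      obtain ⟨n', hn', h⟩ := this x H m (List.mem_map.2 ⟨_, h₁, tag_shiftRight m⟩) hm
      rwa [hx.eq h]
    intro x
    have hx := Subgroup.mem_top x
    rw [← closure_generators, ← Subgroup.mem_toSubmonoid, Subgroup.closure_toSubmonoid_of_finite]
      at hx
    induction hx using Submonoid.closure_induction with
    | mem x hx =>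
      obtain ⟨g, hg, rfl⟩ := hx
      intro K n hn hK
      simp only [List.mem_cons, List.not_mem_nil, or_false] at hg
      rcases hg with rfl | rfl | rfl
      · exact ⟨_, hr' _ (by simp) n hn, hK.conjSwap⟩
      · exact ⟨_, hr' _ (by simp) n hn, hK.conjCycle⟩
      · exact ⟨n, hn, by rwa [conjSubgroup_elt_sixteen]⟩
    | one => exact fun K n hn hK => ⟨n, hn, by rwa [conjSubgroup_one]⟩
    | mul x y _ _ hx hy =>
      intro K n hn hK
      obtain ⟨n', hn', hK'⟩ := hy K n hn hK
      rw [conjSubgroup_mul]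
      exact hx _ n' hn' hK'

/-! ### The conjugacy classes of subgroups -/

theorem equivalence_subgroupConj : Equivalence (subgroupConj (G := WhittenGroup 4)) where
  refl H := ⟨1, conjSubgroup_one H⟩
  symm := by
    rintro H _ ⟨x, rfl⟩
    exact ⟨x⁻¹, by
      change conjSubgroup x⁻¹ (conjSubgroup x H) = H
      rw [← conjSubgroup_mul, inv_mul_cancel, conjSubgroup_one]⟩
  trans := by
    rintro H _ _ ⟨x, rfl⟩ ⟨y, rfl⟩
    exact ⟨y * x, conjSubgroup_mul y x H⟩

/-- A subgroup together with its bit mask and the list of the bit masks of its conjugates. -/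
structure ConjugacyClass where
  /-- The subgroup. -/
  subgroup : Subgroup (WhittenGroup 4)
  /-- The bit mask of the subgroup. -/
  mask : ℕ
  /-- The bit masks of the conjugates of the subgroup. -/
  orbit : List ℕ
  isMask : IsMask mask subgroup
  nodup_orbit : orbit.Nodup
  mask_le : ∀ n ∈ orbit, mask ≤ n
  mem_orbit : ∀ n, n ∈ orbit ↔ ∃ H, subgroupConj subgroup H ∧ IsMask n H

theorem ConjugacyClass.mask_le_of_subgroupConj {C D : ConjugacyClass}
    (h : subgroupConj C.subgroup D.subgroup) : C.mask ≤ D.mask :=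
  C.mask_le _ ((C.mem_orbit _).2 ⟨_, h, D.isMask⟩)

theorem exists_conjugacyClasses {l : List (List ℕ)} {prev acc : ℕ}
    (h : checkRepresentatives l prev acc = true) :
    ∃ L : List ConjugacyClass, L.length = l.length ∧ L.Pairwise (·.mask < ·.mask) ∧
      (∀ C ∈ L, prev < C.mask) ∧ (L.map (·.orbit.length)).sum + acc = 9417 := by
  induction l generalizing prev acc with
  | nil => exact ⟨[], rfl, .nil, by simp, by simpa [checkRepresentatives] using h⟩
  | cons gens l ih =>
    rw [checkRepresentatives, force_eq] at h
    cases ho : orbit [conjSwap, conjCycle] (closureMask gens) with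
    | none => simp [ho] at h
    | some o =>
      simp only [ho, force_eq, Bool.and_eq_true, List.all_eq_true, Nat.blt_eq,
        Nat.ble_eq] at h
      obtain ⟨hg, hlt, hle, h⟩ := h
      obtain ⟨L, h₁, h₂, h₃, h₄⟩ := ih h
      have hm := closureMask_spec hg (by omega)
      obtain ⟨hd, hmem⟩ := orbit_spec hm ho
      refine ⟨⟨_, _, o, hm, hd, hle, fun n => (hmem n).trans ?_⟩ :: L, by simp [h₁],
        .cons h₃ h₂, ?_, ?_⟩
      · exact ⟨fun ⟨x, hx⟩ => ⟨_, ⟨x, rfl⟩, hx⟩, by rintro ⟨_, ⟨x, rfl⟩, hx⟩; exact ⟨x, hx⟩⟩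
      · simp only [List.mem_cons, forall_eq_or_imp]
        exact ⟨hlt, fun C hC => hlt.trans (h₃ C hC)⟩
      · change _ + (o.length + acc) = _ at h₄
        simp only [List.map_cons, List.sum_cons]
        omega

theorem checkRepresentatives_representatives : checkRepresentatives representatives 0 0 = true := by
  decide +kernel

theorem card_subgroup_eq_and_card_quot_eq (h : Nat.card (Subgroup (WhittenGroup 4)) ≤ 9417) :
    Nat.card (Subgroup (WhittenGroup 4)) = 9417 ∧
      Nat.card (Quot (subgroupConj (G := WhittenGroup 4))) = 994 := by
  obtain ⟨L, hlen, hlt, -, hsum⟩ := exists_conjugacyClasses checkRepresentatives_representatives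
  set N := L.flatMap (·.orbit) with hN
  have hnodup : N.Nodup := by
    refine List.nodup_flatMap.2 ⟨fun C _ => C.nodup_orbit, hlt.imp fun {C D} hCD n hC hD => ?_⟩
    obtain ⟨H, hH, hnH⟩ := (C.mem_orbit n).1 hC
    obtain ⟨K, hK, hnK⟩ := (D.mem_orbit n).1 hD
    rw [← hnH.subgroup_eq hnK] at hK
    have := ConjugacyClass.mask_le_of_subgroupConj
      (equivalence_subgroupConj.trans hK (equivalence_subgroupConj.symm hH))
    omega
  have hcard : N.toFinset.card = 9417 := by
    rw [List.toFinset_card_of_nodup hnodup, hN, List.length_flatMap]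
    simpa using hsum
  have hex (n : N.toFinset) : ∃ C ∈ L, ∃ H, subgroupConj C.subgroup H ∧ IsMask n H := by
    obtain ⟨C, hC, hn⟩ := List.mem_flatMap.1 (List.mem_toFinset.1 n.2)
    exact ⟨C, hC, (C.mem_orbit n).1 hn⟩
  choose C hC f hf hfm using hex
  have hinj : Function.Injective f := fun m n hmn =>
    Subtype.ext ((hfm m).eq (hmn ▸ hfm n))
  have hle := Nat.card_le_card_of_injective f hinj
  rw [Nat.card_eq_fintype_card, Fintype.card_coe, hcard] at hle
  have hG := le_antisymm h hle
  have hsurj := ((Nat.bijective_iff_injective_and_card f).2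
    ⟨hinj, by rw [hG, Nat.card_eq_fintype_card, Fintype.card_coe, hcard]⟩).2
  refine ⟨hG, ?_⟩
  have hL : L.length = 994 := hlen.trans (by decide +kernel)
  have hbij : Function.Bijective fun i : Fin L.length =>
      Quot.mk (subgroupConj (G := WhittenGroup 4)) (L.get i).subgroup := by
    constructor
    · intro i j hij
      rw [equivalence_subgroupConj.quot_mk_eq_iff] at hij
      have h₁ := ConjugacyClass.mask_le_of_subgroupConj hij
      have h₂ := ConjugacyClass.mask_le_of_subgroupConj (equivalence_subgroupConj.symm hij)
      rcases lt_trichotomy i j with hlt' | rfl | hlt'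
      · have := List.pairwise_iff_get.1 hlt i j hlt'
        omega
      · rfl
      · have := List.pairwise_iff_get.1 hlt j i hlt'
        omega
    · rintro ⟨H⟩
      obtain ⟨n, rfl⟩ := hsurj H
      obtain ⟨i, hi⟩ := List.get_of_mem (hC n)
      exact ⟨i, Quot.sound (by rw [hi]; exact hf n)⟩
  rw [← Nat.card_eq_of_bijective _ hbij, Nat.card_fin, hL]

/-! ### The data determining a subgroup -/

theorem checkGeneratingPairs :
    (forceList (generatingPairs.map fun p => closureMask [32 * p.1, 32 * p.2.1]) fun L =>
      generatingPairs.all fun p => (List.range 24).all fun g =>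
        force (closureMask [32 * g, 32 * p.1, 32 * p.2.1]) fun m =>
          !(Nat.beq m 0) && L.any (Nat.beq m)) = true := by
  decide +kernel

theorem generatingPairs_spec : ∀ p ∈ generatingPairs, p.1 < 24 ∧ p.2.1 < 24 ∧
    perm p.1 ^ p.2.2.1 = 1 ∧ perm p.2.1 ^ p.2.2.2.1 = 1 ∧
      (perm p.1 * perm p.2.1) ^ p.2.2.2.2 = 1 := by
  decide +kernel

theorem closure_perm_eq {gens gens' : List ℕ} (h : ∀ g ∈ gens, g < 24) (h' : ∀ g ∈ gens', g < 24)
    (h₀ : closureMask (gens.map (32 * ·)) ≠ 0)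
    (he : closureMask (gens.map (32 * ·)) = closureMask (gens'.map (32 * ·))) :
    Subgroup.closure {x | ∃ g ∈ gens, perm g = x} =
      Subgroup.closure {x | ∃ g ∈ gens', perm g = x} := by
  have hlt {l : List ℕ} (hl : ∀ g ∈ l, g < 24) : ∀ g ∈ l.map (32 * ·), g < 768 := by
    intro g hg
    obtain ⟨q, hq, rfl⟩ := List.mem_map.1 hg
    have := hl q hq
    omega
  have himage (l : List ℕ) : {x | ∃ g ∈ l, perm g = x} =
      (SemidirectProduct.rightHom : WhittenGroup 4 →* _) ''
        {x | ∃ g ∈ l.map (32 * ·), elt g = x} := by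
    have (q : ℕ) : (elt (32 * q)).right = perm q := by
      rw [← add_zero (32 * q), elt_add (by norm_num)]
    ext x
    simp [this]
  rw [himage, himage, ← MonoidHom.map_closure, ← MonoidHom.map_closure]
  congr 1
  exact (closureMask_spec (hlt h) h₀).subgroup_eq (he ▸ closureMask_spec (hlt h') (he ▸ h₀))

theorem exists_generatingPair (K : Subgroup (Equiv.Perm (Fin 4))) :
    ∃ p ∈ generatingPairs, K = Subgroup.closure {perm p.1, perm p.2.1} := by
  have hpair (q r : ℕ) : ({perm q, perm r} : Set (Equiv.Perm (Fin 4))) =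
      {x | ∃ g ∈ [q, r], perm g = x} := by
    ext x
    simp [eq_comm]
  suffices ∀ T : Finset (Equiv.Perm (Fin 4)), ∃ p ∈ generatingPairs,
      Subgroup.closure (T : Set (Equiv.Perm (Fin 4))) =
        Subgroup.closure {perm p.1, perm p.2.1} by
    obtain ⟨p, hp, h⟩ := this (K : Set (Equiv.Perm (Fin 4))).toFinite.toFinset
    exact ⟨p, hp, by rw [← h, Set.Finite.coe_toFinset, Subgroup.closure_eq]⟩
  intro T
  induction T using Finset.induction_on with
  | empty =>
    refine ⟨(0, 0, 1, 1, 1), by simp [generatingPairs], ?_⟩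
    have : perm 0 = 1 := by decide +kernel
    simp [this, Subgroup.closure_singleton_one]
  | insert x T _ ih =>
    obtain ⟨p, hp, h⟩ := ih
    obtain ⟨g, hg, rfl⟩ := exists_perm x
    have hcheck := checkGeneratingPairs
    simp only [forceList_eq, force_eq, List.all_eq_true, Bool.and_eq_true, List.any_eq_true,
      Nat.beq_eq, List.mem_map, List.mem_range, Bool.not_eq_true', exists_eq_right'] at hcheck
    obtain ⟨h₀, p', hp', he⟩ := hcheck p hp g hg
    have hlt := generatingPairs_spec p hp
    have hlt' := generatingPairs_spec p' hp'
    have key := closure_perm_eq (gens := [g, p.1, p.2.1]) (gens' := [p'.1, p'.2.1])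
      (by simp [hg, hlt.1, hlt.2.1]) (by simp [hlt'.1, hlt'.2.1])
      (fun h => by simp only [List.map_cons, List.map_nil] at h; simp [h] at h₀) he.symm
    refine ⟨p', hp', ?_⟩
    rw [hpair, ← key, Finset.coe_insert, ← Set.singleton_union, Subgroup.closure_union, h,
      ← Subgroup.closure_union, Set.singleton_union]
    congr 1
    ext y
    simp [eq_comm]

theorem perm_zero : perm 0 = 1 := by
  decide +kernel

theorem elt_of_lt {v : ℕ} (hv : v < 32) : elt v = ⟨vec v, 1⟩ := by
  simpa [perm_zero] using elt_add (q := 0) hv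

theorem exists_elt_of_right_eq_one {x : WhittenGroup 4} (hx : x.right = 1) :
    ∃ v < 32, elt v = x := by
  obtain ⟨v, hv, h⟩ := exists_vec x.left
  exact ⟨v, hv, by rw [elt_of_lt hv, h, ← hx]⟩

theorem lt_of_perm_eq_one {i : ℕ} (hi : i < 768) (h : perm (i / 32) = 1) : i < 32 := by
  obtain ⟨v, hv, h⟩ := exists_elt_of_right_eq_one (x := elt i) h
  rwa [← elt_injOn (by omega) hi h]

theorem elt_xor {q v w : ℕ} (hv : v < 32) (hw : w < 32) :
    elt (32 * q + (v ^^^ w)) = elt v * elt (32 * q + w) := by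
  rw [elt_add (Nat.xor_lt_two_pow (n := 5) hv hw), elt_of_lt hv, elt_add hw, vec_xor]
  ext <;> simp

theorem elt_act {q v w : ℕ} (hq : q < 24) (hv : v < 32) (hw : w < 32) :
    elt (act q w) = elt (32 * q + v) * elt w * (elt (32 * q + v))⁻¹ := by
  have h := vec_act q hq w hw
  rw [eq_mul_inv_iff_mul_eq, elt_of_lt h.1, elt_of_lt hw, elt_add hv, h.2]
  refine SemidirectProduct.ext ?_ ?_
  · simp [mul_comm]
  · simp

theorem pow_spec {x : ℕ} (hx : x < 768) (k : ℕ) : pow x k < 768 ∧ elt (pow x k) = elt x ^ k := by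
  induction k with
  | zero => exact ⟨by norm_num [pow], by rw [pow, elt_zero, pow_zero]⟩
  | succ k ih =>
    rw [pow, force_eq]
    exact ⟨mul_lt ih.1 hx, by rw [elt_mul ih.1 hx, ih.2, pow_succ]⟩

theorem testBit_toMask (l : List ℕ) (i : ℕ) : (toMask l).testBit i = true ↔ i ∈ l := by
  induction l with
  | nil => simp [toMask]
  | cons x l ih =>
    change (1 <<< x ||| toMask l).testBit i = true ↔ _
    rw [Nat.testBit_or, Nat.one_shiftLeft, Nat.testBit_two_pow, Bool.or_eq_true, ih,
      decide_eq_true_iff, List.mem_cons, eq_comm]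

/-- The numbers in `A` with leading digit at a digit of `P` exist, so that digits in `P` can be
cleared. -/
def HasPivots (A : ℕ → Prop) (P : ℕ) : Prop :=
  ∀ i, P.testBit i = true → ∃ y, A y ∧ 2 ^ i ≤ y ∧ y < 2 ^ (i + 1)

theorem testBit_of_le_of_lt {i y : ℕ} (h : 2 ^ i ≤ y) (h' : y < 2 ^ (i + 1)) :
    y.testBit i = true := by
  have : y / 2 ^ i = 1 := Nat.div_eq_of_lt_le (by omega) (by omega)
  simp [Nat.testBit_eq_decide_div_mod_eq, this]

theorem HasPivots.exists_xor_lt {A : ℕ → Prop} {P x : ℕ} (hP : HasPivots A P) (h : x &&& P ≠ 0) :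
    ∃ i y, P.testBit i = true ∧ A y ∧ y < 2 ^ (i + 1) ∧ y ^^^ x < x := by
  obtain ⟨i, hi⟩ := Nat.exists_testBit_of_ne_zero h
  rw [Nat.testBit_and, Bool.and_eq_true] at hi
  obtain ⟨y, hy, hle, hlt⟩ := hP i hi.2
  refine ⟨i, y, hi.2, hy, hlt, Nat.lt_of_testBit i ?_ hi.1 fun j hj => ?_⟩
  · rw [Nat.testBit_xor, hi.1, testBit_of_le_of_lt hle hlt, Bool.xor_self]
  · rw [Nat.testBit_xor,
      Nat.testBit_lt_two_pow (hlt.trans_le (Nat.pow_le_pow_right (by norm_num) hj)),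
      Bool.false_xor]

theorem exists_subspace {A : ℕ → Prop} (h₀ : A 0) (hA : ∀ x y, A x → A y → A (x ^^^ y)) (j : ℕ) :
    ∃ s ∈ subspaces j, s.1 < 2 ^ j ∧ HasPivots A s.1 ∧ (∀ b ∈ s.2.1, b ∈ s.2.2) ∧
      ∀ x, x ∈ s.2.2 ↔ x < 2 ^ j ∧ A x := by
  induction j with
  | zero =>
    refine ⟨_, List.mem_singleton.2 rfl, by simp, by simp [HasPivots], by simp, fun x => ?_⟩
    simp only [List.mem_singleton, pow_zero, Nat.lt_one_iff]
    exact ⟨fun h => ⟨h, h ▸ h₀⟩, And.left⟩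
  | succ j ih =>
    obtain ⟨⟨P, B, S⟩, hs, hlt, hP, hB, hS⟩ := ih
    simp only at hlt hP hB hS
    simp only [subspaces, List.mem_flatMap, List.mem_cons]
    by_cases! hex : ∃ x, 2 ^ j ≤ x ∧ x < 2 ^ (j + 1) ∧ A x
    · classical
      obtain ⟨hle, hx, hAx⟩ := Nat.find_spec hex
      have hmin := fun y => Nat.find_min' (m := y) hex
      set x := Nat.find hex
      have hxj := testBit_of_le_of_lt hle hx
      have hreduced : x &&& P = 0 := by
        by_contra h
        obtain ⟨i, y, hi, hy, hyi, hxy⟩ := hP.exists_xor_lt h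
        have hij : i < j := by
          by_contra hij
          have :=
            Nat.testBit_lt_two_pow (hlt.trans_le (Nat.pow_le_pow_right two_pos (not_lt.1 hij)))
          simp [this] at hi
        have hyj := Nat.testBit_lt_two_pow (hyi.trans_le (Nat.pow_le_pow_right two_pos hij))
        have := hmin (y ^^^ x) ⟨Nat.ge_two_pow_of_testBit (by simp [hxj, hyj]), by omega,
          hA _ _ hy hAx⟩
        omega
      refine ⟨_, ⟨_, hs, .inr (List.mem_map.2 ⟨x, List.mem_filter.2 ⟨?_, ?_⟩, rfl⟩)⟩,
        ?_, ?_, ?_, ?_⟩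
      · rw [List.mem_range'_1]
        omega
      · exact Nat.beq_eq.symm ▸ hreduced
      · exact Nat.or_lt_two_pow (by omega) (by omega)
      · intro i hi
        change (P ||| 2 ^ j).testBit i = true at hi
        rw [Nat.testBit_or, Nat.testBit_two_pow, Bool.or_eq_true, decide_eq_true_iff] at hi
        rcases hi with hi | rfl
        · exact hP i hi
        · exact ⟨x, hAx, hle, hx⟩
      · simp only [List.mem_cons, List.mem_append, List.mem_map]
        rintro b (rfl | hb)
        · exact .inr ⟨0, (hS 0).2 ⟨by positivity, h₀⟩, Nat.xor_zero _⟩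
        · exact .inl (hB b hb)
      · intro z
        simp only [List.mem_append, List.mem_map, hS]
        constructor
        · rintro (⟨hz, hAz⟩ | ⟨y, ⟨hy, hAy⟩, rfl⟩)
          · exact ⟨by omega, hAz⟩
          · exact ⟨Nat.xor_lt_two_pow hx (by omega), hA _ _ hAx hAy⟩
        · rintro ⟨hz, hAz⟩
          rcases lt_or_ge z (2 ^ j) with h | h
          · exact .inl ⟨h, hAz⟩
          · refine .inr ⟨x ^^^ z, ⟨?_, hA _ _ hAx hAz⟩, by
              change x ^^^ (x ^^^ z) = z
              rw [← Nat.xor_assoc, Nat.xor_self, Nat.zero_xor]⟩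
            refine Nat.lt_pow_two_of_testBit _ fun i hi => ?_
            rw [Nat.testBit_xor]
            rcases hi.eq_or_lt with rfl | hi
            · rw [hxj, testBit_of_le_of_lt h hz, Bool.xor_self]
            · rw [Nat.testBit_lt_two_pow (hx.trans_le (Nat.pow_le_pow_right two_pos hi)),
                Nat.testBit_lt_two_pow (hz.trans_le (Nat.pow_le_pow_right two_pos hi)),
                Bool.xor_self]
    · refine ⟨_, ⟨_, hs, .inl rfl⟩, by simp only; omega, hP, hB, fun x => ?_⟩
      rw [hS]
      refine and_congr_left fun hx => ⟨fun h => by omega, fun h => ?_⟩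
      by_contra h'
      exact hex x (by omega) h hx

/-- The data `c` are those of the subgroup `H`. -/
structure IsData (H : Subgroup (WhittenGroup 4))
    (c : (ℕ × List ℕ × List ℕ) × (ℕ × ℕ × ℕ × ℕ × ℕ) × ℕ × ℕ) : Prop where
  mem_iff : ∀ x, x ∈ c.1.2.2 ↔ x < 32 ∧ elt x ∈ H
  map_rightHom : H.map SemidirectProduct.rightHom = Subgroup.closure {perm c.2.1.1, perm c.2.1.2.1}
  fst_lt : c.2.2.1 < 32
  snd_lt : c.2.2.2 < 32
  fst_mem : elt (32 * c.2.1.1 + c.2.2.1) ∈ H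
  snd_mem : elt (32 * c.2.1.2.1 + c.2.2.2) ∈ H

theorem IsData.le {H K : Subgroup (WhittenGroup 4)}
    {c : (ℕ × List ℕ × List ℕ) × (ℕ × ℕ × ℕ × ℕ × ℕ) × ℕ × ℕ} (hH : IsData H c) (hK : IsData K c) :
    H ≤ K := by
  intro h hh
  have hle : H.map SemidirectProduct.rightHom ≤ (H ⊓ K).map SemidirectProduct.rightHom := by
    rw [hH.map_rightHom, Subgroup.closure_le]
    rintro _ (rfl | rfl)
    · exact ⟨_, ⟨hH.fst_mem, hK.fst_mem⟩, by rw [elt_add hH.fst_lt]; rfl⟩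
    · exact ⟨_, ⟨hH.snd_mem, hK.snd_mem⟩, by rw [elt_add hH.snd_lt]; rfl⟩
  obtain ⟨l, hl, e⟩ := hle (Subgroup.mem_map_of_mem _ hh)
  obtain ⟨v, hv, e'⟩ := exists_elt_of_right_eq_one (x := h * l⁻¹) (by
    rw [← SemidirectProduct.rightHom_eq_right, map_mul, map_inv, e, mul_inv_cancel])
  have hvH : elt v ∈ H := e' ▸ mul_mem hh (inv_mem hl.1)
  have hvK : elt v ∈ K := ((hK.mem_iff v).1 ((hH.mem_iff v).2 ⟨hv, hvH⟩)).2
  rw [← inv_mul_cancel_right h l, ← e']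
  exact mul_mem hvK hl.2

/-- Candidates for the data of subgroups. -/
def candidates : List ((ℕ × List ℕ × List ℕ) × (ℕ × ℕ × ℕ × ℕ × ℕ) × ℕ × ℕ) :=
  (subspaces 5).flatMap fun s => generatingPairs.flatMap fun p =>
    (subspaceLifts s p).map fun w => (s, p, w)

theorem sum_length_subspaceLifts : ((subspaces 5).map fun s =>
    (generatingPairs.map fun p => (subspaceLifts s p).length).sum).sum = 9417 := by
  decide +kernel

theorem length_candidates : candidates.length = 9417 := by
  rw [← sum_length_subspaceLifts]
  simp only [candidates, List.length_flatMap, List.length_map]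

theorem exists_reduced {H : Subgroup (WhittenGroup 4)} {P q : ℕ}
    (hP : HasPivots (fun x => x < 32 ∧ elt x ∈ H) P)
    (hq : perm q ∈ H.map SemidirectProduct.rightHom) :
    ∃ v < 32, v &&& P = 0 ∧ elt (32 * q + v) ∈ H := by
  have hex : ∃ v, v < 32 ∧ elt (32 * q + v) ∈ H := by
    obtain ⟨h, hh, e⟩ := hq
    obtain ⟨v, hv, hv'⟩ := exists_vec h.left
    refine ⟨v, hv, ?_⟩
    rw [elt_add hv, hv', ← e]
    exact hh
  classical
  obtain ⟨hv, hvH⟩ := Nat.find_spec hex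
  have hmin := fun w => Nat.find_min' (m := w) hex
  refine ⟨Nat.find hex, hv, ?_, hvH⟩
  by_contra h
  obtain ⟨i, y, -, ⟨hy, hyH⟩, -, hlt⟩ := hP.exists_xor_lt h
  have := hmin _ ⟨Nat.xor_lt_two_pow (n := 5) hy hv, by rw [elt_xor hy hv]; exact mul_mem hyH hvH⟩
  omega

theorem exists_isData (H : Subgroup (WhittenGroup 4)) : ∃ c ∈ candidates, IsData H c := by
  obtain ⟨⟨P, B, S⟩, hs, hlt, hP, hB, hS⟩ := exists_subspace (A := fun x => x < 32 ∧ elt x ∈ H)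
    ⟨by norm_num, by rw [elt_zero]; exact one_mem H⟩
    (fun x y hx hy => ⟨Nat.xor_lt_two_pow (n := 5) hx.1 hy.1, by
      have h := elt_xor (q := 0) hx.1 hy.1
      simp only [mul_zero, zero_add] at h
      rw [h]
      exact mul_mem hx.2 hy.2⟩) 5
  simp only at hlt hP hB hS
  obtain ⟨⟨a, b, k, l, m⟩, hp, hpair⟩ := exists_generatingPair (H.map SemidirectProduct.rightHom)
  obtain ⟨ha, hb, hak, hbl, habm⟩ := generatingPairs_spec _ hp
  simp only at hpair ha hb hak hbl habm
  obtain ⟨v, hv, hvP, hvH⟩ := exists_reduced hP (q := a)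
    (by rw [hpair]; exact Subgroup.subset_closure (by simp))
  obtain ⟨w, hw, hwP, hwH⟩ := exists_reduced hP (q := b)
    (by rw [hpair]; exact Subgroup.subset_closure (by simp))
  have hbit (x : ℕ) (hx : x < 32) (hxH : elt x ∈ H) : bit (toMask S) x = true := by
    rw [bit_eq_testBit, testBit_toMask, hS]
    exact ⟨hx, hx, hxH⟩
  have hpow (x k : ℕ) (hx : x < 768) (hxH : elt x ∈ H) (hk : (elt x).right ^ k = 1) :
      bit (toMask S) (pow x k) = true := by
    obtain ⟨h₁, h₂⟩ := pow_spec hx k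
    refine hbit _ (lt_of_perm_eq_one h₁ ?_) (h₂ ▸ pow_mem hxH k)
    change (elt (pow x k)).right = 1
    rw [h₂, ← hk, ← SemidirectProduct.rightHom_eq_right, map_pow]
  have hact (q u : ℕ) (hq : q < 24) (hu : u < 32) (hH : elt (32 * q + u) ∈ H) (x : ℕ) (hx : x ∈ B) :
      bit (toMask S) (act q x) = true := by
    obtain ⟨hx₁, -, hx₂⟩ := (hS x).1 (hB x hx)
    exact hbit _ (vec_act q hq x hx₁).1
      (elt_act hq hu hx₁ ▸ mul_mem (mul_mem hH hx₂) (inv_mem hH))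
  have hav : (elt (32 * a + v)).right = perm a := by rw [elt_add hv]
  have hbw : (elt (32 * b + w)).right = perm b := by rw [elt_add hw]
  refine ⟨((P, B, S), (a, b, k, l, m), v, w), ?_, fun x => by rw [hS]; tauto, hpair, hv, hw, hvH,
    hwH⟩
  refine List.mem_flatMap.2 ⟨_, hs, List.mem_flatMap.2 ⟨_, hp, List.mem_map.2 ⟨_, ?_, rfl⟩⟩⟩
  have hall : (B.all fun x => bit (toMask S) (act a x) && bit (toMask S) (act b x)) = true := by
    rw [List.all_eq_true]
    intro x hx
    rw [hact a v ha hv hvH x hx, hact b w hb hw hwH x hx, Bool.and_self]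
  simp only [subspaceLifts, lifts, hall, cond_true, forceList_eq, force_eq, List.mem_flatMap,
    List.mem_map, List.mem_filter, List.mem_range, Bool.and_eq_true, Nat.beq_eq,
    Nat.mul_eq, Nat.add_eq]
  refine ⟨v, ⟨hv, hvP, hpow _ _ (by omega) hvH (by rw [hav, hak])⟩, w,
    ⟨⟨hw, hwP, hpow _ _ (by omega) hwH (by rw [hbw, hbl])⟩, hpow _ _ ?_ ?_ ?_⟩, rfl⟩
  · exact mul_lt (by omega) (by omega)
  · change elt (mul (32 * a + v) (32 * b + w)) ∈ H
    rw [elt_mul (by omega) (by omega)]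
    exact mul_mem hvH hwH
  · change (elt (mul (32 * a + v) (32 * b + w))).right ^ m = 1
    rw [elt_mul (by omega) (by omega), SemidirectProduct.mul_right, hav, hbw, habm]

theorem card_subgroup_le : Nat.card (Subgroup (WhittenGroup 4)) ≤ 9417 := by
  choose c hc hH using exists_isData
  choose i hi using fun H => List.get_of_mem (hc H)
  have hinj : Function.Injective i := fun H K h => by
    have he : c H = c K := by rw [← hi, h, hi]
    exact le_antisymm ((hH H).le (he ▸ hH K)) (IsData.le (hH K) (he ▸ hH H))
  have := Nat.card_le_card_of_injective i hinj
  rwa [Nat.card_fin, length_candidates] at this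

end WhittenGroup

/-- The Whitten group Γ_4 (a group of order 768) has exactly
9417 subgroups, and these subgroups fall into exactly 994 conjugacy classes. -/
theorem whittenGroup_4_subgroup_counts :
    Nat.card (WhittenGroup 4) = 768 ∧
    Nat.card (Subgroup (WhittenGroup 4)) = 9417 ∧
    Nat.card (Quot (subgroupConj (G := WhittenGroup 4))) = 994 :=
  ⟨WhittenGroup.card_whittenGroup,
    WhittenGroup.card_subgroup_eq_and_card_quot_eq WhittenGroup.card_subgroup_le⟩
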